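/- Suppose α is a silhouette curve with axis d (i.e. d is a unit vector with ⟪N(s), d⟫ = 0 for all s), κ(s) > 0 for all s, and k_n(s)² + τ_g(s)² > 0 for all s. Then τ_g(s) = 0 for all s (α is a line of curvature) if and only if k_g(s) = 0 for all s and τ(s) = 0 for all s (α is a plane geodesic curve). -/

import Mathlib

open scoped RealInnerProductSpace

noncomputable section

/-- The cross product on `EuclideanSpace ℝ (Fin 3)`. -/
def cross3 (u v : EuclideanSpace ℝ (Fin 3)) : EuclideanSpace ℝ (Fin 3) :=
  (EuclideanSpace.equiv (Fin 3) ℝ).symm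
    (crossProduct ((EuclideanSpace.equiv (Fin 3) ℝ) u) ((EuclideanSpace.equiv (Fin 3) ℝ) v))

lemma inner_eq_coords (u v : EuclideanSpace ℝ (Fin 3)) :
    ⟪u, v⟫ = u 0 * v 0 + u 1 * v 1 + u 2 * v 2 := by
  simp [PiLp.inner_apply, Fin.sum_univ_three]
  ring

@[simp] lemma cross3_apply_zero (u v : EuclideanSpace ℝ (Fin 3)) :
    cross3 u v 0 = u 1 * v 2 - u 2 * v 1 := by
  simp [cross3, crossProduct]

@[simp] lemma cross3_apply_one (u v : EuclideanSpace ℝ (Fin 3)) :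
    cross3 u v 1 = u 2 * v 0 - u 0 * v 2 := by
  simp [cross3, crossProduct]

@[simp] lemma cross3_apply_two (u v : EuclideanSpace ℝ (Fin 3)) :
    cross3 u v 2 = u 0 * v 1 - u 1 * v 0 := by
  simp [cross3, crossProduct]

lemma inner_left_cross3 (u v : EuclideanSpace ℝ (Fin 3)) : ⟪u, cross3 u v⟫ = 0 := by
  simp only [inner_eq_coords, cross3_apply_zero, cross3_apply_one, cross3_apply_two]
  ring

lemma inner_right_cross3 (u v : EuclideanSpace ℝ (Fin 3)) : ⟪v, cross3 u v⟫ = 0 := by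
  simp only [inner_eq_coords, cross3_apply_zero, cross3_apply_one, cross3_apply_two]
  ring

lemma cross3_smul_right (c : ℝ) (u v : EuclideanSpace ℝ (Fin 3)) :
    cross3 u (c • v) = c • cross3 u v := by
  simp [cross3]

lemma cross3_anticomm (u v : EuclideanSpace ℝ (Fin 3)) : cross3 u v = -cross3 v u := by
  ext i
  fin_cases i <;> simp <;> ring

/-- The Gram determinant of three vectors is the square of their triple product. -/
lemma inner_cross3_sq (u v w : EuclideanSpace ℝ (Fin 3)) :
    ⟪w, cross3 u v⟫ ^ 2 =
      ⟪w, w⟫ * (⟪u, u⟫ * ⟪v, v⟫ - ⟪u, v⟫ ^ 2) - ⟪w, u⟫ ^ 2 * ⟪v, v⟫ - ⟪w, v⟫ ^ 2 * ⟪u, u⟫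
        + 2 * ⟪w, u⟫ * ⟪w, v⟫ * ⟪u, v⟫ := by
  simp only [inner_eq_coords, cross3_apply_zero, cross3_apply_one, cross3_apply_two]
  ring

/-- The Parseval identity for the frame `u, v, u × v`. -/
lemma inner_self_eq_frame {u v : EuclideanSpace ℝ (Fin 3)} (hu : ‖u‖ = 1) (hv : ‖v‖ = 1)
    (huv : ⟪u, v⟫ = 0) (w : EuclideanSpace ℝ (Fin 3)) :
    ⟪w, w⟫ = ⟪w, u⟫ ^ 2 + ⟪w, v⟫ ^ 2 + ⟪w, cross3 u v⟫ ^ 2 := by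
  rw [inner_cross3_sq, huv, real_inner_self_eq_norm_sq u, real_inner_self_eq_norm_sq v, hu, hv]
  ring

lemma norm_cross3 {u v : EuclideanSpace ℝ (Fin 3)} (hu : ‖u‖ = 1) (hv : ‖v‖ = 1)
    (huv : ⟪u, v⟫ = 0) : ‖cross3 u v‖ = 1 := by
  have h : ⟪cross3 u v, cross3 u v⟫ = ⟪u, u⟫ * ⟪v, v⟫ - ⟪u, v⟫ ^ 2 := by
    simp only [inner_eq_coords, cross3_apply_zero, cross3_apply_one, cross3_apply_two]
    ring
  rw [huv, real_inner_self_eq_norm_sq, real_inner_self_eq_norm_sq, real_inner_self_eq_norm_sq,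
    hu, hv] at h
  nlinarith [norm_nonneg (cross3 u v)]

lemma eq_frame_expansion {u v : EuclideanSpace ℝ (Fin 3)} (hu : ‖u‖ = 1) (hv : ‖v‖ = 1)
    (huv : ⟪u, v⟫ = 0) (w : EuclideanSpace ℝ (Fin 3)) :
    w = ⟪w, u⟫ • u + ⟪w, v⟫ • v + ⟪w, cross3 u v⟫ • cross3 u v := by
  rw [← sub_eq_zero, ← inner_self_eq_zero (𝕜 := ℝ), inner_self_eq_frame hu hv huv]
  have hcu : ⟪cross3 u v, u⟫ = 0 := by rw [real_inner_comm, inner_left_cross3]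
  have hcv : ⟪cross3 u v, v⟫ = 0 := by rw [real_inner_comm, inner_right_cross3]
  have hvu : ⟪v, u⟫ = 0 := by rw [real_inner_comm, huv]
  simp [inner_sub_left, inner_add_left, real_inner_smul_left, hcu, hcv, huv, hvu,
    inner_left_cross3, inner_right_cross3, norm_cross3 hu hv huv, hu, hv]

lemma Differentiable.cross3 {f g : ℝ → EuclideanSpace ℝ (Fin 3)} (hf : Differentiable ℝ f)
    (hg : Differentiable ℝ g) : Differentiable ℝ fun s => cross3 (f s) (g s) := by
  rw [differentiable_euclidean] at hf hg ⊢
  have := hf 0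
  have := hf 1
  have := hf 2
  have := hg 0
  have := hg 1
  have := hg 2
  intro i
  fin_cases i <;> simp <;> fun_prop

/-- Differentiating `⟪f, g⟫ = c`. -/
lemma inner_deriv_eq_neg {E : Type*} [NormedAddCommGroup E] [InnerProductSpace ℝ E]
    {f g : ℝ → E} (hf : Differentiable ℝ f) (hg : Differentiable ℝ g)
    {c : ℝ} (h : ∀ s, ⟪f s, g s⟫ = c) (s : ℝ) : ⟪deriv f s, g s⟫ = -⟪f s, deriv g s⟫ := by
  have h₁ := deriv_inner_apply ℝ (hf s) (hg s)
  rw [funext h, deriv_const] at h₁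
  linarith

/-- The derivative of a unit vector field is orthogonal to it. -/
lemma inner_deriv_self_eq_zero {E : Type*} [NormedAddCommGroup E] [InnerProductSpace ℝ E]
    {f : ℝ → E} (hf : Differentiable ℝ f) (h : ∀ s, ‖f s‖ = 1) (s : ℝ) :
    ⟪deriv f s, f s⟫ = 0 := by
  have h₁ := inner_deriv_eq_neg hf hf (c := 1)
    (fun s => by rw [real_inner_self_eq_norm_sq, h]; norm_num) s
  rw [real_inner_comm (deriv f s) (f s)] at h₁
  linarith

theorem stmt9
    (α N : ℝ → EuclideanSpace ℝ (Fin 3))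
    (hα : ContDiff ℝ (⊤ : ℕ∞) α) (hN : ContDiff ℝ (⊤ : ℕ∞) N)
    (hunit : ∀ s, ‖deriv α s‖ = 1)
    (hNunit : ∀ s, ‖N s‖ = 1)
    (hNT : ∀ s, ⟪N s, deriv α s⟫ = 0)
    (T B : ℝ → EuclideanSpace ℝ (Fin 3))
    (hT : ∀ s, T s = deriv α s)
    (hB : ∀ s, B s = cross3 (N s) (T s))
    (kn kg τg : ℝ → ℝ)
    (hkn : ∀ s, kn s = ⟪deriv T s, N s⟫)
    (hkg : ∀ s, kg s = ⟪deriv T s, B s⟫)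
    (hτg : ∀ s, τg s = ⟪deriv B s, N s⟫)
    (κ τ : ℝ → ℝ) (n b : ℝ → EuclideanSpace ℝ (Fin 3))
    (hκ : ∀ s, κ s = ‖deriv (deriv α) s‖)
    (hκpos : ∀ s, 0 < κ s)
    (hn : ∀ s, n s = (κ s)⁻¹ • deriv (deriv α) s)
    (hb : ∀ s, b s = cross3 (deriv α s) (n s))
    (hτ : ∀ s, τ s = ⟪cross3 (deriv α s) (deriv (deriv α) s), deriv (deriv (deriv α)) s⟫ / κ s ^ 2)
    (d : EuclideanSpace ℝ (Fin 3)) (hd : ‖d‖ = 1)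
    (hsil : ∀ s, ⟪N s, d⟫ = 0)
    (hpos : ∀ s, 0 < kn s ^ 2 + τg s ^ 2) :
    (∀ s, τg s = 0) ↔ ((∀ s, kg s = 0) ∧ ∀ s, τ s = 0) := by
  obtain rfl : T = deriv α := funext hT
  obtain rfl : B = fun s => cross3 (N s) (deriv α s) := funext hB
  have hα₁ : ContDiff ℝ (⊤ : ℕ∞) (deriv α) := (contDiff_infty_iff_deriv.1 hα).2
  have hα₂ : ContDiff ℝ (⊤ : ℕ∞) (deriv (deriv α)) := (contDiff_infty_iff_deriv.1 hα₁).2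
  have dT : Differentiable ℝ (deriv α) := hα₁.differentiable (by simp)
  have dT' : Differentiable ℝ (deriv (deriv α)) := hα₂.differentiable (by simp)
  have dN : Differentiable ℝ N := hN.differentiable (by simp)
  have dB := dN.cross3 dT
  have hT'T (s : ℝ) : ⟪deriv (deriv α) s, deriv α s⟫ = 0 :=
    inner_deriv_self_eq_zero dT hunit s
  have hT' (s : ℝ) : deriv (deriv α) s = kn s • N s + kg s • cross3 (N s) (deriv α s) := by
    have h := eq_frame_expansion (hNunit s) (hunit s) (hNT s) (deriv (deriv α) s)
    rwa [hT'T, zero_smul, add_zero, ← hkn, ← hkg] at h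
  have torsion_eq (hg : ∀ s, kg s = 0) (s : ℝ) : τ s = τg s := by
    have hT's : deriv (deriv α) s = kn s • N s := by rw [hT', hg, zero_smul, add_zero]
    have hκs : κ s ^ 2 = kn s ^ 2 := by
      rw [hκ, hT's, norm_smul, hNunit, mul_one, Real.norm_eq_abs, sq_abs]
    have h := inner_deriv_eq_neg dT' dB (fun s => (hkg s).symm.trans (hg s)) s
    rw [hT's, real_inner_smul_left, real_inner_comm, real_inner_comm (deriv _ s) (N s),
      ← hτg] at h
    have hκ0 : κ s ^ 2 ≠ 0 := pow_ne_zero 2 (hκpos s).ne'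
    rw [hτ, div_eq_iff hκ0, hT's, cross3_smul_right, cross3_anticomm, real_inner_smul_left,
      inner_neg_left, h, hκs]
    ring
  have hgeod (h0 : ∀ s, τg s = 0) : ∀ s, kg s = 0 := by
    have hTd (s : ℝ) : ⟪deriv α s, d⟫ = 0 := by
      have hkn0 : kn s ≠ 0 := fun h => by simpa [h, h0 s] using hpos s
      have hN'd := inner_deriv_eq_neg dN (differentiable_const d) hsil s
      have hN'T := inner_deriv_eq_neg dN dT hNT s
      have hN'N := inner_deriv_self_eq_zero dN hNunit s
      have hN'B := inner_deriv_eq_neg dN dB (fun s => inner_left_cross3 _ _) s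
      rw [real_inner_comm (deriv _ s), ← hτg, h0, neg_zero] at hN'B
      rw [real_inner_comm (deriv (deriv α) s), ← hkn] at hN'T
      rw [eq_frame_expansion (hNunit s) (hunit s) (hNT s) (deriv N s), hN'B, hN'T, hN'N] at hN'd
      simpa [inner_add_left, real_inner_smul_left, hsil, hkn0] using hN'd
    intro s
    have hBd := inner_self_eq_frame (hNunit s) (hunit s) (hNT s) d
    rw [real_inner_comm, real_inner_self_eq_norm_sq, hd, real_inner_comm (N s), hsil,
      real_inner_comm (deriv α s), hTd, real_inner_comm (cross3 _ _)] at hBd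
    have hT'd := inner_deriv_eq_neg dT (differentiable_const d) hTd s
    rw [hT', inner_add_left, real_inner_smul_left, real_inner_smul_left, hsil] at hT'd
    have hq : ⟪cross3 (N s) (deriv α s), d⟫ ≠ 0 := fun h => by norm_num [h] at hBd
    simpa [hq] using hT'd
  constructor
  · intro h0
    exact ⟨hgeod h0, fun s => (torsion_eq (hgeod h0) s).trans (h0 s)⟩
  · rintro ⟨hg, h0⟩ s
    exact (torsion_eq hg s).symm.trans (h0 s)
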